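/- There exists a constant C > 0 such that for all integers n ≥ 1 and all j with 1 ≤ j ≤ n and j < 2·log(n+2): |φ_{n,j} − (jπ + π/2)/(n+2)| ≤ C·(j/(n+2)² + e^{−2j}/(n+2)). -/

import Mathlib

open Real Set Filter Topology

/-- The symbol `g(x) = (2 sin(x/2))^4`. -/
noncomputable def g (x : ℝ) : ℝ := (2 * Real.sin (x / 2)) ^ 4

/-- The `n × n` pentadiagonal Toeplitz matrix generated by `g`. -/
noncomputable def T (n : ℕ) : Matrix (Fin n) (Fin n) ℝ :=
  Matrix.of fun j k =>
    if ((j : ℤ) - (k : ℤ)) = 0 then 6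
    else if ((j : ℤ) - (k : ℤ)) = 1 ∨ ((j : ℤ) - (k : ℤ)) = -1 then -4
    else if ((j : ℤ) - (k : ℤ)) = 2 ∨ ((j : ℤ) - (k : ℤ)) = -2 then 1
    else 0

lemma sum_fin_ite_eq {n : ℕ} (f : ℤ → ℝ) (m : ℤ) (hf : m < 0 ∨ (n : ℤ) ≤ m → f m = 0) :
    ∑ k : Fin n, (if ((k : ℕ) : ℤ) = m then f k else 0) = f m := by
  by_cases h : m < 0 ∨ (n : ℤ) ≤ m
  · rw [hf h]
    refine Finset.sum_eq_zero fun k _ => if_neg ?_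
    have := k.isLt
    omega
  · push Not at h
    obtain ⟨l, rfl⟩ := Int.eq_ofNat_of_zero_le h.1
    have hl : l < n := by omega
    rw [Finset.sum_eq_single ⟨l, hl⟩]
    · simp
    · intro k _ hk
      refine if_neg fun h' => hk (Fin.ext ?_)
      simpa using h'
    · simp

lemma T_mulVec_apply {n : ℕ} (f : ℤ → ℝ) (h₁ : f (-2) = 0) (h₂ : f (-1) = 0)
    (h₃ : f n = 0) (h₄ : f (n + 1) = 0) (i : Fin n) :
    (T n).mulVec (fun k => f (k : ℕ)) i =
      f ((i : ℕ) - 2) - 4 * f ((i : ℕ) - 1) + 6 * f (i : ℕ) - 4 * f ((i : ℕ) + 1)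
        + f ((i : ℕ) + 2) := by
  have hi := i.isLt
  have hz : ∀ m : ℤ, -2 ≤ m → m ≤ n + 1 → (m < 0 ∨ (n : ℤ) ≤ m → f m = 0) := by
    intro m ha hb hm
    have : m = -2 ∨ m = -1 ∨ m = n ∨ m = n + 1 := by omega
    rcases this with rfl | rfl | rfl | rfl <;> assumption
  rw [← sum_fin_ite_eq f ((i : ℕ) - 2 : ℤ) (hz _ (by omega) (by omega)),
    ← sum_fin_ite_eq f ((i : ℕ) - 1 : ℤ) (hz _ (by omega) (by omega)),
    ← sum_fin_ite_eq f ((i : ℕ) : ℤ) (hz _ (by omega) (by omega)),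
    ← sum_fin_ite_eq f ((i : ℕ) + 1 : ℤ) (hz _ (by omega) (by omega)),
    ← sum_fin_ite_eq f ((i : ℕ) + 2 : ℤ) (hz _ (by omega) (by omega))]
  simp only [Finset.mul_sum, ← Finset.sum_add_distrib, ← Finset.sum_sub_distrib, Matrix.mulVec,
    dotProduct]
  refine Finset.sum_congr rfl fun k _ => ?_
  simp only [T, Matrix.of_apply]
  split_ifs <;> first | omega | ring

lemma sq_mem_spectrum_T {n : ℕ} (hn : 1 ≤ n) (p q : ℤ → ℝ) {σ : ℝ} (hσ : σ ≠ 0)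
    (hp : ∀ k, p (k + 1) + p (k - 1) = (2 - σ) * p k)
    (hq : ∀ k, q (k + 1) + q (k - 1) = (2 + σ) * q k)
    (h₁ : p (-2) + q (-2) = 0) (h₂ : p (-1) + q (-1) = 0)
    (h₃ : p n + q n = 0) (h₄ : p (n + 1) + q (n + 1) = 0)
    (hne : ¬ (p (-1) = 0 ∧ p 0 = 0)) :
    σ ^ 2 ∈ spectrum ℝ (T n) := by
  rw [← Matrix.spectrum_toLin']
  refine Module.End.HasEigenvalue.mem_spectrum
    (Module.End.hasEigenvalue_of_hasEigenvector
      (x := fun k : Fin n => p (k : ℕ) + q (k : ℕ)) ⟨?_, ?_⟩)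
  · rw [Module.End.mem_eigenspace_iff]
    ext i
    rw [Matrix.toLin'_apply, T_mulVec_apply (fun k => p k + q k) h₁ h₂ h₃ h₄]
    simp only [Pi.smul_apply, smul_eq_mul]
    have e₁ := hp ((i : ℕ) + 1)
    have e₂ := hp (i : ℕ)
    have e₃ := hp ((i : ℕ) - 1)
    have f₁ := hq ((i : ℕ) + 1)
    have f₂ := hq (i : ℕ)
    have f₃ := hq ((i : ℕ) - 1)
    ring_nf at e₁ e₂ e₃ f₁ f₂ f₃ ⊢
    linear_combination e₁ + e₃ - (2 + σ) * e₂ + f₁ + f₃ - (2 - σ) * f₂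
  · intro h0
    have hz : ∀ m : ℤ, -2 ≤ m → m ≤ n + 1 → p m + q m = 0 := by
      intro m ha hb
      by_cases hm : m < 0 ∨ (n : ℤ) ≤ m
      · have : m = -2 ∨ m = -1 ∨ m = n ∨ m = n + 1 := by omega
        rcases this with rfl | rfl | rfl | rfl <;> assumption
      · push Not at hm
        obtain ⟨l, rfl⟩ := Int.eq_ofNat_of_zero_le hm.1
        exact congrFun h0 ⟨l, by omega⟩
    have hpz : ∀ m : ℤ, -1 ≤ m → m ≤ n → p m = 0 := by
      intro m ha hb
      have e₁ := hz (m - 1) (by omega) (by omega)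
      have e₂ := hz m (by omega) (by omega)
      have e₃ := hz (m + 1) (by omega) (by omega)
      have : σ * p m = 0 := by
        linear_combination (1 / 2) * hp m + (1 / 2) * hq m - (1 / 2) * e₁ - (1 / 2) * e₃
          + (1 + σ / 2) * e₂
      exact (mul_eq_zero.1 this).resolve_left hσ
    exact hne ⟨hpz _ (by omega) (by omega), hpz _ (by omega) (by omega)⟩

lemma symm_mem_spectrum_T {n : ℕ} (hn : 1 ≤ n) {b B : ℝ} (hb : b ∈ Ioo 0 (π / 2))
    (hB : sinh B = sin b)
    (h : sin ((n + 2) * b) * (cosh ((n + 2) * B) * cosh B)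
      + cos ((n + 2) * b) * (cos b * sinh ((n + 2) * B)) = 0) :
    (2 * sin b) ^ 4 ∈ spectrum ℝ (T n) := by
  have hs : 0 < sin b := sin_pos_of_pos_of_lt_pi hb.1 (by linarith [hb.2, pi_pos])
  have hs2 : 0 < sin (2 * b) := sin_pos_of_pos_of_lt_pi (by linarith [hb.1]) (by linarith [hb.2])
  have key : cosh ((n + 2) * B + B) * cos ((n + 2) * b - b)
      - cos ((n + 2) * b + b) * cosh ((n + 2) * B - B) = 0 := by
    rw [cosh_add, cosh_sub, cos_add, cos_sub, hB]
    linear_combination 2 * sin b * h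
  have := sq_mem_spectrum_T (σ := (2 * sin b) ^ 2) hn
    (fun k => cosh ((n + 2) * B + B) * cos ((2 * k - n + 1) * b))
    (fun k => - cos ((n + 2) * b + b) * cosh ((2 * k - n + 1) * B)) (by positivity) ?_ ?_ ?_ ?_ ?_ ?_ ?_
  · convert this using 1
    ring
  · intro k
    push_cast
    rw [show (2 * ((k : ℝ) + 1) - n + 1) * b = (2 * (k : ℝ) - n + 1) * b + 2 * b by ring,
      show (2 * ((k : ℝ) - 1) - n + 1) * b = (2 * (k : ℝ) - n + 1) * b - 2 * b by ring,
      cos_add _ (2 * b), cos_sub _ (2 * b), cos_two_mul, cos_sq']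
    ring
  · intro k
    push_cast
    rw [show (2 * ((k : ℝ) + 1) - n + 1) * B = (2 * (k : ℝ) - n + 1) * B + 2 * B by ring,
      show (2 * ((k : ℝ) - 1) - n + 1) * B = (2 * (k : ℝ) - n + 1) * B - 2 * B by ring,
      cosh_add _ (2 * B), cosh_sub _ (2 * B), cosh_two_mul, cosh_sq, hB]
    ring
  · push_cast
    rw [show (2 * -2 - (n : ℝ) + 1) * b = -((n + 2) * b + b) by ring,
      show (2 * -2 - (n : ℝ) + 1) * B = -((n + 2) * B + B) by ring, cos_neg, cosh_neg]
    ring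
  · push_cast
    rw [show (2 * -1 - (n : ℝ) + 1) * b = -((n + 2) * b - b) by ring,
      show (2 * -1 - (n : ℝ) + 1) * B = -((n + 2) * B - B) by ring, cos_neg, cosh_neg]
    linear_combination key
  · push_cast
    rw [show (2 * (n : ℝ) - n + 1) * b = (n + 2) * b - b by ring,
      show (2 * (n : ℝ) - n + 1) * B = (n + 2) * B - B by ring]
    linear_combination key
  · push_cast
    rw [show (2 * ((n : ℝ) + 1) - n + 1) * b = (n + 2) * b + b by ring,
      show (2 * ((n : ℝ) + 1) - n + 1) * B = (n + 2) * B + B by ring]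
    ring
  · push_cast
    rintro ⟨h₁, h₂⟩
    have h₁ := (mul_eq_zero.1 h₁).resolve_left (cosh_pos _).ne'
    have h₂ := (mul_eq_zero.1 h₂).resolve_left (cosh_pos _).ne'
    rw [show (2 * 0 - (n : ℝ) + 1) * b = (2 * -1 - n + 1) * b + 2 * b by ring, cos_add, h₁] at h₂
    have h₃ : sin ((2 * -1 - n + 1) * b) = 0 := by
      refine ((mul_eq_zero (b := sin (2 * b))).1 ?_).resolve_right hs2.ne'
      linarith
    have := sin_sq_add_cos_sq ((2 * -1 - n + 1) * b)
    rw [h₁, h₃] at this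
    norm_num at this

lemma antisymm_mem_spectrum_T {n : ℕ} (hn : 1 ≤ n) {b B : ℝ} (hb : b ∈ Ioo 0 (π / 2))
    (hB : sinh B = sin b)
    (h : sin ((n + 2) * b) * (cos b * cosh ((n + 2) * B))
      - cos ((n + 2) * b) * (sinh ((n + 2) * B) * cosh B) = 0) :
    (2 * sin b) ^ 4 ∈ spectrum ℝ (T n) := by
  have hs : 0 < sin b := sin_pos_of_pos_of_lt_pi hb.1 (by linarith [hb.2, pi_pos])
  have hs2 : 0 < sin (2 * b) := sin_pos_of_pos_of_lt_pi (by linarith [hb.1]) (by linarith [hb.2])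
  have hB0 : 0 < B := sinh_pos_iff.1 (hB ▸ hs)
  have hA : 0 < sinh ((n + 2) * B + B) := sinh_pos_iff.2 (by positivity)
  have key : sinh ((n + 2) * B + B) * sin ((n + 2) * b - b)
      - sin ((n + 2) * b + b) * sinh ((n + 2) * B - B) = 0 := by
    rw [sinh_add, sinh_sub, sin_add, sin_sub, hB]
    linear_combination 2 * sin b * h
  have := sq_mem_spectrum_T (σ := (2 * sin b) ^ 2) hn
    (fun k => sinh ((n + 2) * B + B) * sin ((2 * k - n + 1) * b))
    (fun k => - sin ((n + 2) * b + b) * sinh ((2 * k - n + 1) * B)) (by positivity) ?_ ?_ ?_ ?_ ?_ ?_ ?_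
  · convert this using 1
    ring
  · intro k
    push_cast
    rw [show (2 * ((k : ℝ) + 1) - n + 1) * b = (2 * (k : ℝ) - n + 1) * b + 2 * b by ring,
      show (2 * ((k : ℝ) - 1) - n + 1) * b = (2 * (k : ℝ) - n + 1) * b - 2 * b by ring,
      sin_add _ (2 * b), sin_sub _ (2 * b), cos_two_mul, cos_sq']
    ring
  · intro k
    push_cast
    rw [show (2 * ((k : ℝ) + 1) - n + 1) * B = (2 * (k : ℝ) - n + 1) * B + 2 * B by ring,
      show (2 * ((k : ℝ) - 1) - n + 1) * B = (2 * (k : ℝ) - n + 1) * B - 2 * B by ring,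
      sinh_add _ (2 * B), sinh_sub _ (2 * B), cosh_two_mul, cosh_sq, hB]
    ring
  · push_cast
    rw [show (2 * -2 - (n : ℝ) + 1) * b = -((n + 2) * b + b) by ring,
      show (2 * -2 - (n : ℝ) + 1) * B = -((n + 2) * B + B) by ring, sin_neg, sinh_neg]
    ring
  · push_cast
    rw [show (2 * -1 - (n : ℝ) + 1) * b = -((n + 2) * b - b) by ring,
      show (2 * -1 - (n : ℝ) + 1) * B = -((n + 2) * B - B) by ring, sin_neg, sinh_neg]
    linear_combination -key
  · push_cast
    rw [show (2 * (n : ℝ) - n + 1) * b = (n + 2) * b - b by ring,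
      show (2 * (n : ℝ) - n + 1) * B = (n + 2) * B - B by ring]
    linear_combination key
  · push_cast
    rw [show (2 * ((n : ℝ) + 1) - n + 1) * b = (n + 2) * b + b by ring,
      show (2 * ((n : ℝ) + 1) - n + 1) * B = (n + 2) * B + B by ring]
    ring
  · push_cast
    rintro ⟨h₁, h₂⟩
    have h₁ := (mul_eq_zero.1 h₁).resolve_left hA.ne'
    have h₂ := (mul_eq_zero.1 h₂).resolve_left hA.ne'
    rw [show (2 * 0 - (n : ℝ) + 1) * b = (2 * -1 - n + 1) * b + 2 * b by ring, sin_add, h₁] at h₂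
    have h₃ : cos ((2 * -1 - n + 1) * b) = 0 := by
      refine ((mul_eq_zero (b := sin (2 * b))).1 ?_).resolve_right hs2.ne'
      linarith
    have := sin_sq_add_cos_sq ((2 * -1 - n + 1) * b)
    rw [h₁, h₃] at this
    norm_num at this

lemma two_div_pi_mul_le_of_sinh_eq_sin {b B : ℝ} (hb0 : 0 < b) (hb : b ≤ 1 / 2)
    (hB : sinh B = sin b) : 2 / π * b ≤ B := by
  rw [← sinh_le_sinh, hB]
  have hy : 2 / π * b ≤ 0.64 * b := by
    refine mul_le_mul_of_nonneg_right ?_ hb0.le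
    rw [div_le_iff₀ pi_pos]
    linarith [pi_gt_d2]
  set y := 2 / π * b
  have hy0 : 0 < y := by positivity
  have hexp : exp y ≤ 1 + y + y ^ 2 := by
    have := (abs_le.1 (abs_exp_sub_one_sub_id_le (x := y) (by rw [abs_of_pos hy0]; linarith))).2
    linarith
  have hexp' : 1 - y ≤ exp (-y) := by linarith [add_one_le_exp (-y)]
  have hsin := sin_gt_sub_cube hb0
  rw [sinh_eq]
  nlinarith [mul_nonneg hb0.le (sub_nonneg.2 hb), mul_nonneg (mul_nonneg hb0.le (sub_nonneg.2 hb)) hb0.le]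

lemma cosh_le_of_sinh_eq_sin {b B : ℝ} (hB : sinh B = sin b) : cosh B ≤ 1 + b ^ 2 / 2 := by
  refine le_of_sq_le_sq ?_ (by positivity)
  have : sin b ^ 2 ≤ b ^ 2 := sq_le_sq.2 abs_sin_le_abs
  rw [cosh_sq, hB]
  nlinarith [sq_nonneg (b ^ 2)]

lemma exp_neg_le_mul_cosh (A : ℝ) : exp (-A) ≤ 2 * exp (-(2 * A)) * cosh A := by
  have h₁ : exp (-(2 * A)) * exp A = exp (-A) := by rw [← exp_add]; ring_nf
  have h₂ : 0 < exp (-(2 * A)) * exp (-A) := by positivity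
  rw [cosh_eq]
  linarith

lemma abs_symm_coeff_sub_le {b A B : ℝ} (hb : b ∈ Ioo 0 (π / 2)) (hB : sinh B = sin b)
    (hA : 1 ≤ A) :
    |cosh A * cosh B - cos b * sinh A|
      ≤ (cosh A * cosh B + cos b * sinh A) * (2 * b ^ 2 + 8 * exp (-(2 * A))) := by
  have hc : 0 < cos b := cos_pos_of_mem_Ioo ⟨by linarith [hb.1, pi_pos], hb.2⟩
  have h₁ := cosh_le_of_sinh_eq_sin hB
  have h₂ := one_sub_sq_div_two_le_cos (x := b)
  have h₃ := exp_neg_le_mul_cosh A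
  have h₄ := cosh_sub_sinh A
  have h₅ := cosh_pos A
  have h₆ := one_le_cosh B
  have h₇ := cos_le_one b
  have h₈ : 0 < sinh A := sinh_pos_iff.2 (by linarith)
  have h₉ := exp_pos (-A)
  have e := exp_pos (-(2 * A))
  have hle : cosh A ≤ cosh A * cosh B + cos b * sinh A := by nlinarith [mul_pos hc h₈]
  have key : cosh A * cosh B - cos b * sinh A = cosh A * (cosh B - cos b) + cos b * exp (-A) := by
    rw [← h₄]; ring
  rw [key, abs_of_nonneg (by have : 0 ≤ cosh B - cos b := by linarith
                             positivity)]
  calc cosh A * (cosh B - cos b) + cos b * exp (-A)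
      ≤ cosh A * b ^ 2 + 1 * (2 * exp (-(2 * A)) * cosh A) := by gcongr; linarith
    _ ≤ cosh A * (2 * b ^ 2 + 8 * exp (-(2 * A))) := by nlinarith [mul_pos h₅ e, sq_nonneg b]
    _ ≤ _ := by gcongr

lemma abs_antisymm_coeff_sub_le {b A B : ℝ} (hb : b ∈ Ioo 0 (π / 2)) (hB : sinh B = sin b)
    (hA : 1 ≤ A) :
    |cos b * cosh A - sinh A * cosh B|
      ≤ (cos b * cosh A + sinh A * cosh B) * (2 * b ^ 2 + 8 * exp (-(2 * A))) := by
  have hc : 0 < cos b := cos_pos_of_mem_Ioo ⟨by linarith [hb.1, pi_pos], hb.2⟩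
  have h₁ := cosh_le_of_sinh_eq_sin hB
  have h₂ := one_sub_sq_div_two_le_cos (x := b)
  have h₃ := exp_neg_le_mul_cosh A
  have h₄ := cosh_sub_sinh A
  have h₅ := cosh_pos A
  have h₆ := one_le_cosh B
  have h₇ := cos_le_one b
  have h₈ : 0 < sinh A := sinh_pos_iff.2 (by linarith)
  have h₉ := exp_pos (-A)
  have e := exp_pos (-(2 * A))
  have hB2 : cosh B ≤ 2 := by
    have h := cosh_sq B
    rw [hB] at h
    nlinarith [sin_sq_le_one b]
  have hsinh : cosh A / 2 ≤ sinh A := by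
    have : 2 ≤ exp A := by linarith [add_one_le_exp A]
    have h' : exp A * exp (-A) = 1 := by rw [← exp_add]; simp
    rw [cosh_eq, sinh_eq]
    nlinarith
  have hle : cosh A / 2 ≤ cos b * cosh A + sinh A * cosh B := by nlinarith [mul_pos hc h₅]
  have key : cos b * cosh A - sinh A * cosh B
      = -(cosh A * (cosh B - cos b)) + cosh B * exp (-A) := by
    rw [← h₄]; ring
  calc |cos b * cosh A - sinh A * cosh B|
      ≤ cosh A * (cosh B - cos b) + cosh B * exp (-A) := by
        rw [key, abs_le]
        have : 0 ≤ cosh A * (cosh B - cos b) := mul_nonneg h₅.le (by linarith)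
        have : 0 ≤ cosh B * exp (-A) := by positivity
        constructor <;> linarith
    _ ≤ cosh A * b ^ 2 + 2 * (2 * exp (-(2 * A)) * cosh A) := by gcongr; linarith
    _ = cosh A / 2 * (2 * b ^ 2 + 8 * exp (-(2 * A))) := by ring
    _ ≤ _ := by gcongr

lemma abs_le_of_sin_sub_pi_div_four {P Q δ c : ℝ} (hP : 0 < P) (hQ : 0 < Q) (hδ : |δ| ≤ π / 2)
    (h : sin (δ - π / 4) * P + cos (δ - π / 4) * Q = 0) (hc : |P - Q| ≤ (P + Q) * c) :
    |δ| ≤ π / 2 * c := by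
  have h2 : (0 : ℝ) < √2 / 2 := by positivity
  have e : (P + Q) * sin δ = (P - Q) * cos δ := by
    rw [sin_sub, cos_sub, sin_pi_div_four, cos_pi_div_four] at h
    refine mul_left_cancel₀ h2.ne' ?_
    linear_combination h
  have hs : |sin δ| ≤ c := by
    refine le_of_mul_le_mul_left ?_ (add_pos hP hQ)
    calc (P + Q) * |sin δ| = |P - Q| * |cos δ| := by
          rw [← abs_of_pos (add_pos hP hQ), ← abs_mul, e, abs_mul]
      _ ≤ |P - Q| * 1 := by gcongr; exact abs_cos_le_one δ
      _ ≤ (P + Q) * c := by linarith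
  have h₃ := (mul_abs_le_abs_sin hδ).trans hs
  calc |δ| = π / 2 * (2 / π * |δ|) := by field_simp
    _ ≤ π / 2 * c := by gcongr

lemma abs_le_of_sin_add_pi_div_four {P Q δ c : ℝ} (hP : 0 < P) (hQ : 0 < Q) (hδ : |δ| ≤ π / 2)
    (h : sin (δ + π / 4) * P - cos (δ + π / 4) * Q = 0) (hc : |P - Q| ≤ (P + Q) * c) :
    |δ| ≤ π / 2 * c := by
  rw [← abs_neg δ] at hδ ⊢
  refine abs_le_of_sin_sub_pi_div_four hP hQ hδ ?_ hc
  rw [show -δ - π / 4 = -(δ + π / 4) by ring, sin_neg, cos_neg]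
  linarith

/-- The secular equation, in the half angle `b`, for the eigenvalue `(2 * sin b) ^ 4` of `T n`:
odd indices belong to symmetric eigenvectors, even indices to antisymmetric ones. -/
def SecularEq (n j : ℕ) (b : ℝ) : Prop :=
  (Odd j ∧ sin ((n + 2) * b) * (cosh ((n + 2) * arsinh (sin b)) * cosh (arsinh (sin b)))
      + cos ((n + 2) * b) * (cos b * sinh ((n + 2) * arsinh (sin b))) = 0) ∨
  (Even j ∧ sin ((n + 2) * b) * (cos b * cosh ((n + 2) * arsinh (sin b)))
      - cos ((n + 2) * b) * (sinh ((n + 2) * arsinh (sin b)) * cosh (arsinh (sin b))) = 0)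

lemma SecularEq.mem_spectrum_T {n j : ℕ} {b : ℝ} (hn : 1 ≤ n) (hb : b ∈ Ioo 0 (π / 2))
    (h : SecularEq n j b) : (2 * sin b) ^ 4 ∈ spectrum ℝ (T n) := by
  rcases h with ⟨_, h⟩ | ⟨_, h⟩
  · exact symm_mem_spectrum_T hn hb (sinh_arsinh _) h
  · exact antisymm_mem_spectrum_T hn hb (sinh_arsinh _) h

lemma Ioo_half_angle_subset {n j : ℕ} (hjn : j ≤ n) :
    Icc (j * (π / 2) / (n + 2)) ((j + 1) * (π / 2) / (n + 2)) ⊆ Ico 0 (π / 2) := by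
  have hj : (j : ℝ) ≤ n := by exact_mod_cast hjn
  have hpi := pi_pos
  refine Icc_subset_Ico_iff ?_ |>.2 ⟨by positivity, ?_⟩
  · gcongr
    linarith
  · rw [div_lt_iff₀ (by positivity)]
    nlinarith

lemma exists_secularEq {n j : ℕ} (hj : 1 ≤ j) (hjn : j ≤ n) :
    ∃ b ∈ Ioo (j * (π / 2) / (n + 2)) ((j + 1) * (π / 2) / (n + 2) : ℝ), SecularEq n j b := by
  have hpi := pi_pos
  have hsub := Ioo_half_angle_subset hjn
  set x : ℝ := j * (π / 2) / (n + 2) with hx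
  set y : ℝ := (j + 1) * (π / 2) / (n + 2) with hy
  have hN : (0 : ℝ) < n + 2 := by positivity
  have hj' : (1 : ℝ) ≤ j := by exact_mod_cast hj
  have hxy : x ≤ y := by
    rw [hx, hy]
    gcongr
    linarith
  have hx0 : 0 < x := by positivity
  have hNx : (n + 2) * x = j * (π / 2) := by rw [hx]; field_simp
  have hNy : (n + 2) * y = (j + 1) * (π / 2) := by rw [hy]; field_simp
  have hcos : ∀ b ∈ Icc x y, 0 < cos b := fun b hb =>
    cos_pos_of_mem_Ioo ⟨by linarith [(hsub hb).1], (hsub hb).2⟩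
  have hsinh : ∀ b ∈ Icc x y, 0 < sinh ((n + 2) * arsinh (sin b)) := fun b hb => by
    have : 0 < sin b := sin_pos_of_pos_of_lt_pi (by linarith [hb.1]) (by linarith [(hsub hb).2])
    exact sinh_pos_iff.2 (mul_pos hN (arsinh_pos_iff.2 this))
  have hxm := left_mem_Icc.2 hxy
  have hym := right_mem_Icc.2 hxy
  have hcx := hcos x hxm
  have hcy := hcos y hym
  have hsx := hsinh x hxm
  have hsy := hsinh y hym
  have hcc := cosh_pos
  have hcont : Continuous fun b => arsinh (sin b) := continuous_sin.arsinh
  rcases Nat.even_or_odd' j with ⟨k, hk | hk⟩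
  · have hjk : (j : ℝ) = 2 * k := by exact_mod_cast hk
    let F : ℝ → ℝ := fun b => (-1) ^ k * (sin ((n + 2) * b) * (cos b * cosh ((n + 2) * arsinh (sin b)))
      - cos ((n + 2) * b) * (sinh ((n + 2) * arsinh (sin b)) * cosh (arsinh (sin b))))
    have hF : Continuous F := by fun_prop
    have hFx : F x < 0 := by
      simp only [F]
      rw [hNx, hjk, show 2 * (k : ℝ) * (π / 2) = k * π by ring, sin_nat_mul_pi, cos_nat_mul_pi]
      have := mul_pos hsx (hcc (arsinh (sin x)))
      have h1 : ((-1 : ℝ) ^ k) * (-1) ^ k = 1 := by rw [← mul_pow]; simp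
      linear_combination this + (-sinh ((n + 2) * arsinh (sin x)) * cosh (arsinh (sin x))) * h1
    have hFy : 0 < F y := by
      simp only [F]
      rw [hNy, hjk, show (2 * (k : ℝ) + 1) * (π / 2) = k * π + π / 2 by ring, sin_add_pi_div_two,
        cos_add_pi_div_two, sin_nat_mul_pi, cos_nat_mul_pi]
      have := mul_pos hcy (hcc ((n + 2) * arsinh (sin y)))
      have h1 : ((-1 : ℝ) ^ k) * (-1) ^ k = 1 := by rw [← mul_pow]; simp
      linear_combination this - (cos y * cosh ((n + 2) * arsinh (sin y))) * h1
    obtain ⟨b, hb, hb0⟩ := intermediate_value_Ioo hxy hF.continuousOn ⟨hFx, hFy⟩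
    exact ⟨b, hb, .inr ⟨⟨k, by omega⟩, (mul_eq_zero.1 hb0).resolve_left (by simp)⟩⟩
  · have hjk : (j : ℝ) = 2 * k + 1 := by exact_mod_cast hk
    let F : ℝ → ℝ := fun b => (-1) ^ k *
      (sin ((n + 2) * b) * (cosh ((n + 2) * arsinh (sin b)) * cosh (arsinh (sin b)))
      + cos ((n + 2) * b) * (cos b * sinh ((n + 2) * arsinh (sin b))))
    have hF : Continuous F := by fun_prop
    have hFx : 0 < F x := by
      simp only [F]
      rw [hNx, hjk, show (2 * (k : ℝ) + 1) * (π / 2) = k * π + π / 2 by ring, sin_add_pi_div_two,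
        cos_add_pi_div_two, sin_nat_mul_pi, cos_nat_mul_pi]
      have := mul_pos (hcc ((n + 2) * arsinh (sin x))) (hcc (arsinh (sin x)))
      have h1 : ((-1 : ℝ) ^ k) * (-1) ^ k = 1 := by rw [← mul_pow]; simp
      linear_combination this - (cosh ((n + 2) * arsinh (sin x)) * cosh (arsinh (sin x))) * h1
    have hFy : F y < 0 := by
      simp only [F]
      rw [hNy, hjk, show (2 * (k : ℝ) + 1 + 1) * (π / 2) = k * π + π by ring, sin_add_pi,
        cos_add_pi, sin_nat_mul_pi, cos_nat_mul_pi]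
      have := mul_pos hcy hsy
      have h1 : ((-1 : ℝ) ^ k) * (-1) ^ k = 1 := by rw [← mul_pow]; simp
      linear_combination this - (cos y * sinh ((n + 2) * arsinh (sin y))) * h1
    obtain ⟨b, hb, hb0⟩ := intermediate_value_Ioo' hxy hF.continuousOn ⟨hFy, hFx⟩
    exact ⟨b, hb, .inl ⟨⟨k, by omega⟩, (mul_eq_zero.1 hb0).resolve_left (by simp)⟩⟩

lemma SecularEq.abs_sub_le_of_le_half {n j : ℕ} {b : ℝ} (hj : 1 ≤ j) (hjn : j ≤ n)
    (hb : b ∈ Ioo (j * (π / 2) / (n + 2)) ((j + 1) * (π / 2) / (n + 2) : ℝ))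
    (hb2 : b ≤ 1 / 2) (h : SecularEq n j b) :
    |(n + 2) * b - (j * (π / 2) + π / 4)| ≤ π / 2 * (2 * b ^ 2 + 8 * exp (-2 * j)) := by
  have hpi := pi_pos
  have hN : (0 : ℝ) < n + 2 := by positivity
  have hj' : (1 : ℝ) ≤ j := by exact_mod_cast hj
  have hb1 : b ∈ Ioo 0 (π / 2) :=
    ⟨lt_of_le_of_lt (by positivity) hb.1, (Ioo_half_angle_subset hjn (Ioo_subset_Icc_self hb)).2⟩
  have hlo : j * (π / 2) < (n + 2) * b := by
    have := (div_lt_iff₀ hN).1 hb.1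
    linarith
  have hhi : (n + 2) * b < (j + 1) * (π / 2) := by
    have := (lt_div_iff₀ hN).1 hb.2
    linarith
  have hA : (j : ℝ) ≤ (n + 2) * arsinh (sin b) := by
    have h₁ := two_div_pi_mul_le_of_sinh_eq_sin hb1.1 hb2 (sinh_arsinh (sin b))
    calc (j : ℝ) = 2 / π * (j * (π / 2)) := by field_simp
      _ ≤ 2 / π * ((n + 2) * b) := by gcongr
      _ = (n + 2) * (2 / π * b) := by ring
      _ ≤ _ := by gcongr
  have hcos : 0 < cos b := cos_pos_of_mem_Ioo ⟨by linarith [hb1.1], hb1.2⟩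
  have hsinh : 0 < sinh ((n + 2) * arsinh (sin b)) := sinh_pos_iff.2 (by linarith)
  have hexp : exp (-(2 * ((n + 2) * arsinh (sin b)))) ≤ exp (-2 * j) := exp_le_exp.2 (by linarith)
  set δ : ℝ := (n + 2) * b - (j * (π / 2) + π / 4) with hδ
  have hδ' : |δ| ≤ π / 2 := by
    rw [abs_le]
    constructor <;> linarith
  have hA1 := hj'.trans hA
  refine le_trans (b := π / 2 * (2 * b ^ 2 + 8 * exp (-(2 * ((n + 2) * arsinh (sin b))))))
    ?_ (by gcongr)
  rcases h with ⟨⟨k, hk⟩, h⟩ | ⟨⟨k, hk⟩, h⟩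
  · have hjk : (j : ℝ) = 2 * k + 1 := by exact_mod_cast hk
    refine abs_le_of_sin_sub_pi_div_four (by positivity) (by positivity) hδ' ?_
      (abs_symm_coeff_sub_le hb1 (sinh_arsinh _) hA1)
    rw [show δ - π / 4 = (n + 2) * b - ((k + 1 : ℕ) : ℝ) * π by rw [hδ, hjk]; push_cast; ring,
      sin_sub_nat_mul_pi, cos_sub_nat_mul_pi]
    linear_combination (-1) ^ (k + 1) * h
  · have hjk : (j : ℝ) = k + k := by exact_mod_cast hk
    refine abs_le_of_sin_add_pi_div_four (by positivity) (by positivity) hδ' ?_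
      (abs_antisymm_coeff_sub_le hb1 (sinh_arsinh _) hA1)
    rw [show δ + π / 4 = (n + 2) * b - k * π by rw [hδ, hjk]; ring,
      sin_sub_nat_mul_pi, cos_sub_nat_mul_pi]
    linear_combination (-1) ^ k * h

lemma SecularEq.abs_sub_le {n j : ℕ} {b : ℝ} (hj : 1 ≤ j) (hjn : j ≤ n)
    (hb : b ∈ Ioo (j * (π / 2) / (n + 2)) ((j + 1) * (π / 2) / (n + 2) : ℝ))
    (h : SecularEq n j b) :
    |2 * b - (j * π + π / 2) / (n + 2)|
      ≤ 100 * (j / ((n : ℝ) + 2) ^ 2 + exp (-2 * j) / (n + 2)) := by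
  have hpi := pi_pos
  have hpi4 : π < 3.15 := pi_lt_d2
  have hN : (0 : ℝ) < n + 2 := by positivity
  have hj' : (1 : ℝ) ≤ j := by exact_mod_cast hj
  have hjn' : (j : ℝ) ≤ n := by exact_mod_cast hjn
  have hexp := exp_pos (-2 * (j : ℝ))
  have hlo : j * (π / 2) < (n + 2) * b := by
    have := (div_lt_iff₀ hN).1 hb.1
    linarith
  have hhi : (n + 2) * b < (j + 1) * (π / 2) := by
    have := (lt_div_iff₀ hN).1 hb.2
    linarith
  have hb0 : 0 < b := lt_of_le_of_lt (by positivity) hb.1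
  have hNb : (n + 2) * b ≤ 3.15 * j := by nlinarith
  have e : 2 * b - (j * π + π / 2) / (n + 2)
      = 2 * ((n + 2) * b - (j * (π / 2) + π / 4)) / (n + 2) := by
    field_simp
    ring
  have e' : 100 * (j / ((n : ℝ) + 2) ^ 2 + exp (-2 * j) / (n + 2))
      = 100 * (j / ((n : ℝ) + 2) + exp (-2 * j)) / (n + 2) := by
    field_simp
  rw [e, e', abs_div, abs_of_pos hN, abs_mul, abs_two]
  refine div_le_div_of_nonneg_right ?_ hN.le
  rcases le_or_gt b (1 / 2) with hb2 | hb2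
  · have h₁ := h.abs_sub_le_of_le_half hj hjn hb hb2
    have h₂ : b ^ 2 ≤ 10 * (j / ((n : ℝ) + 2)) := by
      have hb' : b ≤ 3.15 * (j / ((n : ℝ) + 2)) := by
        rw [← mul_div_assoc, le_div_iff₀ hN]
        linarith
      have hq : j / ((n : ℝ) + 2) ≤ 1 := by
        rw [div_le_one hN]
        linarith
      have hq0 : 0 ≤ j / ((n : ℝ) + 2) := by positivity
      nlinarith
    calc 2 * |(n + 2) * b - (j * (π / 2) + π / 4)|
        ≤ 2 * (π / 2 * (2 * b ^ 2 + 8 * exp (-2 * j))) := by gcongr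
      _ = π * (2 * b ^ 2 + 8 * exp (-2 * j)) := by ring
      _ ≤ 3.15 * (2 * (10 * (j / ((n : ℝ) + 2))) + 8 * exp (-2 * j)) := by gcongr
      _ ≤ _ := by
        have hq0 : 0 ≤ j / ((n : ℝ) + 2) := by positivity
        linarith
  · have h₁ : 1 ≤ 10 * (j / ((n : ℝ) + 2)) := by
      rw [← mul_div_assoc, le_div_iff₀ hN]
      nlinarith
    have h₂ : |(n + 2) * b - (j * (π / 2) + π / 4)| ≤ 1 := by
      rw [abs_le]
      constructor <;> linarith
    linarith

lemma eq_of_strictMono_of_mem_spectrum {n : ℕ} {A : Matrix (Fin n) (Fin n) ℝ} {u v : Fin n → ℝ}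
    (hu : StrictMono u) (hv : StrictMono v) (hus : ∀ i, u i ∈ spectrum ℝ A)
    (hvs : ∀ i, v i ∈ spectrum ℝ A) : u = v := by
  classical
  have hcard : A.charpoly.roots.toFinset.card ≤ n :=
    (Multiset.toFinset_card_le _).trans <| (Polynomial.card_roots' _).trans <| by simp
  have key : ∀ w : Fin n → ℝ, StrictMono w → (∀ i, w i ∈ spectrum ℝ A) →
      Set.range w = A.charpoly.roots.toFinset := by
    intro w hw hws
    have : Finset.univ.image w = A.charpoly.roots.toFinset := by
      refine Finset.eq_of_subset_of_card_le (fun x hx => ?_) ?_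
      · obtain ⟨i, -, rfl⟩ := Finset.mem_image.1 hx
        rw [Multiset.mem_toFinset, Polynomial.mem_roots A.charpoly_monic.ne_zero]
        exact Matrix.mem_spectrum_iff_isRoot_charpoly.1 (hws i)
      · rw [Finset.card_image_of_injective _ hw.injective]
        simpa using hcard
    rw [← this]
    simp
  exact (hu.range_inj hv).1 ((key u hu hus).trans (key v hv hvs).symm)

lemma g_strictMonoOn : StrictMonoOn g (Ico 0 π) := by
  intro x hx y hy hxy
  have h₁ : 0 ≤ sin (x / 2) :=
    sin_nonneg_of_nonneg_of_le_pi (by linarith [hx.1]) (by linarith [hx.1, hx.2])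
  have h₂ : sin (x / 2) < sin (y / 2) :=
    sin_lt_sin_of_lt_of_le_pi_div_two (by linarith [hx.1, pi_pos]) (by linarith [hy.2]) (by linarith)
  exact pow_lt_pow_left₀ (by linarith) (by positivity) (by norm_num)

theorem stmt14
    (lam : ℕ → ℕ → ℝ)
    (hmono : ∀ n, 1 ≤ n → ∀ j k, 1 ≤ j → j < k → k ≤ n → lam n j < lam n k)
    (hspec : ∀ n, 1 ≤ n → ∀ j, 1 ≤ j → j ≤ n → lam n j ∈ spectrum ℝ (T n))
    (phi : ℕ → ℕ → ℝ)
    (hphi : ∀ n, 1 ≤ n → ∀ j, 1 ≤ j → j ≤ n →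
      phi n j ∈ Set.Ioo 0 Real.pi ∧ g (phi n j) = lam n j)
    : ∃ C : ℝ, 0 < C ∧ ∀ n : ℕ, 1 ≤ n → ∀ j : ℕ, 1 ≤ j → j ≤ n →
      (j : ℝ) < 2 * Real.log ((n : ℝ) + 2) →
      |phi n j - ((j : ℝ) * Real.pi + Real.pi / 2) / ((n : ℝ) + 2)|
        ≤ C * ((j : ℝ) / ((n : ℝ) + 2) ^ 2 + Real.exp (-2 * (j : ℝ)) / ((n : ℝ) + 2)) := by
  refine ⟨100, by norm_num, fun n hn j hj hjn _ => ?_⟩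
  have hex : ∀ i : Fin n, ∃ b ∈ Ioo (((i + 1 : ℕ) : ℝ) * (π / 2) / (n + 2))
      ((((i + 1 : ℕ) : ℝ) + 1) * (π / 2) / (n + 2) : ℝ), SecularEq n (i + 1) b :=
    fun i => exists_secularEq (by omega) i.isLt
  choose b hb hsec using hex
  have hb1 : ∀ i, b i ∈ Ioo 0 (π / 2) := fun i =>
    ⟨lt_of_le_of_lt (by positivity) (hb i).1,
      (Ioo_half_angle_subset (j := i + 1) i.isLt (Ioo_subset_Icc_self (hb i))).2⟩
  have hb2 : ∀ i, 2 * b i ∈ Ico 0 π := fun i =>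
    ⟨by linarith [(hb1 i).1], by linarith [(hb1 i).2]⟩
  have hbmono : StrictMono b := by
    intro i k hik
    refine (hb i).2.trans_le (le_trans ?_ (hb k).1.le)
    have : ((i + 1 : ℕ) : ℝ) + 1 ≤ ((k + 1 : ℕ) : ℝ) := by
      have : (i : ℕ) < k := hik
      exact_mod_cast (by omega : (i : ℕ) + 1 + 1 ≤ k + 1)
    gcongr
  have heq := eq_of_strictMono_of_mem_spectrum (A := T n) (u := fun i => lam n (i + 1))
    (v := fun i => g (2 * b i))
    (fun i k hik => hmono n hn _ _ (by omega) (by simpa using hik) k.isLt)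
    (fun i k hik => g_strictMonoOn (hb2 i) (hb2 k) (by linarith [hbmono hik]))
    (fun i => hspec n hn _ (by omega) i.isLt)
    (fun i => by
      have := (hsec i).mem_spectrum_T hn (hb1 i)
      rwa [g, mul_div_cancel_left₀ _ (two_ne_zero' ℝ)])
  obtain ⟨i, rfl⟩ : ∃ i, j = i + 1 := ⟨j - 1, by omega⟩
  have hphi' := hphi n hn (i + 1) hj hjn
  have hgi : g (phi n (i + 1)) = g (2 * b ⟨i, hjn⟩) :=
    hphi'.2.trans (congrFun heq ⟨i, hjn⟩)
  rw [g_strictMonoOn.injOn (Ioo_subset_Ico_self hphi'.1) (hb2 _) hgi]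
  exact (hsec ⟨i, hjn⟩).abs_sub_le hj hjn (hb ⟨i, hjn⟩)
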